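/- Let $\{X_\alpha\}_{\alpha\in A}$ be a family of $T_1$ topological spaces each of which is $\omega$-bounded-pracompact, let $y=(y_\alpha)$ be a point of the product $\prod_{\alpha\in A} X_\alpha$, and let $Y=\{x\in\prod_{\alpha\in A} X_\alpha : \{\alpha\in A : x_\alpha\ne y_\alpha\}\text{ is countable}\}$ with the subspace topology. Then $Y$ is $\omega$-bounded-pracompact. -/

import Mathlib

def OmegaBoundedPracompact (X : Type*) [TopologicalSpace X] : Prop :=
  ∃ D : Set X, Dense D ∧ ∀ C : Set X, C ⊆ D → C.Countable → IsCompact (closure C)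

/-- In a `T1` space, adding one point to a set all of whose countable subsets have compact closure
preserves this property. -/
theorem isCompact_closure_of_subset_insert {X : Type*} [TopologicalSpace X] [T1Space X]
    {D C : Set X} {y : X} (hD : ∀ C : Set X, C ⊆ D → C.Countable → IsCompact (closure C))
    (hCD : C ⊆ insert y D) (hC : C.Countable) : IsCompact (closure C) := by
  have hsub : closure C ⊆ insert y (closure (C \ {y})) :=
    closure_minimal
      (fun x hx => or_iff_not_imp_left.2 fun hxy => subset_closure ⟨hx, hxy⟩)
      (by rw [Set.insert_eq]; exact isClosed_singleton.union isClosed_closure)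
  refine IsCompact.of_isClosed_subset ?_ isClosed_closure hsub
  exact (hD _ (fun x hx => (hCD hx.1).resolve_left hx.2) (hC.mono Set.sdiff_subset)).insert y

/-- The points of a `Σ`-product with coordinates in dense sets or equal to the base point
are dense. -/
theorem dense_sigma_product {A : Type*} {X : A → Type*} [∀ α, TopologicalSpace (X α)]
    (y : ∀ α, X α) {D : ∀ α, Set (X α)} (hD : ∀ α, Dense (D α)) :
    Dense {x : {x : ∀ α, X α | {α : A | x α ≠ y α}.Countable} |
      ∀ α, x.1 α ∈ insert (y α) (D α)} := by
  classical
  intro x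
  rw [mem_closure_iff]
  rintro _ ⟨U, hU, rfl⟩ hx
  obtain ⟨F, u, hu, hFU⟩ := isOpen_pi_iff.1 hU x.1 hx
  have hne : ∀ α, ∃ d ∈ D α, α ∈ F → d ∈ u α := by
    intro α
    by_cases hα : α ∈ F
    · obtain ⟨d, hdu, hdD⟩ := (hD α).inter_open_nonempty _ (hu α hα).1 ⟨_, (hu α hα).2⟩
      exact ⟨d, hdD, fun _ => hdu⟩
    · have : Nonempty (X α) := ⟨y α⟩
      obtain ⟨d, hd⟩ := (hD α).nonempty
      exact ⟨d, hd, fun h => absurd h hα⟩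
  choose d hdD hdu using hne
  let z : ∀ α, X α := fun α => if α ∈ F then d α else y α
  have hz : {α : A | z α ≠ y α}.Countable := by
    refine F.countable_toSet.mono fun α hα => ?_
    by_contra hF
    exact hα (if_neg hF)
  refine ⟨⟨z, hz⟩, hFU fun α hα => ?_, fun α => ?_⟩
  · have hzα : z α = d α := if_pos hα
    simpa only [hzα] using hdu α hα
  · by_cases hα : α ∈ F
    · exact Or.inr (by simpa [z, hα] using hdD α)
    · exact Or.inl (if_neg hα)

theorem sigma_product_of_omega_bounded_pracompact {A : Type*} {X : A → Type*}
    [∀ α, TopologicalSpace (X α)] [∀ α, T1Space (X α)]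
    (h : ∀ α, OmegaBoundedPracompact (X α)) (y : ∀ α, X α) :
    OmegaBoundedPracompact {x : ∀ α, X α | {α : A | x α ≠ y α}.Countable} := by
  choose D hD hDc using h
  refine ⟨_, dense_sigma_product y hD, fun C hCD hC => ?_⟩
  let P : ∀ α, Set (X α) := fun α => (fun x => x.1 α) '' C
  let K : Set (∀ α, X α) := Set.univ.pi fun α => closure (P α)
  have hK : IsCompact K := isCompact_univ_pi fun α =>
    isCompact_closure_of_subset_insert (hDc α)
      (Set.image_subset_iff.2 fun x hx => hCD hx α) (hC.image _)
  have hKclosed : IsClosed K := isClosed_set_pi fun α _ => isClosed_closure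
  have hKY : K ⊆ {x : ∀ α, X α | {α : A | x α ≠ y α}.Countable} := by
    intro x hx
    refine (hC.biUnion fun c _ => c.2).mono fun α hα => ?_
    by_contra hS
    have hP : P α ⊆ {y α} := by
      rintro _ ⟨c, hc, rfl⟩
      by_contra hne
      exact hS (Set.mem_biUnion hc hne)
    exact hα (closure_minimal hP isClosed_singleton (hx α trivial))
  have hCK : C ⊆ Subtype.val ⁻¹' K := fun c hc α _ => subset_closure ⟨c, hc, rfl⟩
  refine IsCompact.of_isClosed_subset ?_ isClosed_closure
    (closure_minimal hCK (hKclosed.preimage continuous_subtype_val))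
  exact Topology.IsInducing.subtypeVal.isCompact_preimage' hK (by simpa using hKY)
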